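/- Fix natural numbers 0 ≤ k ≤ n. The number of crossingless matchings of the 2n points {1,…,2n} that match no two of the first n−k points to each other and no two of the last k points to each other is the binomial coefficient C(n,k). -/

import Mathlib

/-- `a` is a crossingless matching of the `m` points `{1,…,m}`: a fixed-point-free
involution of `{1,…,m}` with no indices `i < j < a i < a j`.  Functions are
normalized to be the identity outside `{1,…,m}`, so that a crossingless matching
is determined by the function `a : ℕ → ℕ`. -/
def IsCrossinglessMatching (m : ℕ) (a : ℕ → ℕ) : Prop :=
  (∀ i, 1 ≤ i → i ≤ m → 1 ≤ a i ∧ a i ≤ m) ∧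
  (∀ i, 1 ≤ i → i ≤ m → a (a i) = i) ∧
  (∀ i, 1 ≤ i → i ≤ m → a i ≠ i) ∧
  (∀ i j, 1 ≤ i → i < j → j < a i → ¬ a i < a j) ∧
  (∀ i, i = 0 ∨ m < i → a i = i)

/-- `B(n;k₁,k₂)`: crossingless matchings of the `n+k₁+k₂` points `{1,…,n+k₁+k₂}`
matching no two of the first `k₁` points to each other and no two of the last
`k₂` points to each other. -/
def IsPlatformMatching (n k₁ k₂ : ℕ) (a : ℕ → ℕ) : Prop :=
  IsCrossinglessMatching (n + k₁ + k₂) a ∧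
  (∀ i j, 1 ≤ i → i ≤ k₁ → 1 ≤ j → j ≤ k₁ → i ≠ j → a i ≠ j) ∧
  (∀ i j, n + k₁ + 1 ≤ i → i ≤ n + k₁ + k₂ → n + k₁ + 1 ≤ j → j ≤ n + k₁ + k₂ →
    i ≠ j → a i ≠ j)

open Finset in
/-- Every ballot sequence, with `S` the set of its opening positions, carries a partial
crossingless matching of each prefix whose unmatched points are openers not below any arc. -/
theorem exists_partial_crossingless_matching (S : Finset ℕ) (m : ℕ)
    (hS : ∀ t ≤ m, t ≤ 2 * #{i ∈ Icc 1 t | i ∈ S}) (t : ℕ) (ht : t ≤ m) :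
    ∃ a : ℕ → ℕ, (∀ i, a (a i) = i) ∧ (∀ i, i = 0 ∨ t < i → a i = i) ∧
      (∀ i j, i < j → j < a i → ¬ a i < a j ∧ a j ≠ j) ∧
      (∀ i, 1 ≤ i → i ≤ t → (i ∈ S ↔ i ≤ a i)) ∧
      #{i ∈ Icc 1 t | a i = i} + t = 2 * #{i ∈ Icc 1 t | i ∈ S} := by
  induction t with
  | zero => exact ⟨id, by simp, by simp, by simp; omega, by intro i; omega, by simp⟩
  | succ t ih =>
    obtain ⟨a, hinv, hout, hnc, hop, hcard⟩ := ih (by omega)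
    have hIcc : Icc 1 (t + 1) = insert (t + 1) (Icc 1 t) := by ext; simp; omega
    have hnot (p : ℕ → Prop) [DecidablePred p] : t + 1 ∉ {i ∈ Icc 1 t | p i} := by simp
    have hSt := hS (t + 1) ht
    have hat : a (t + 1) = t + 1 := hout _ (by omega)
    by_cases hmem : t + 1 ∈ S
    · refine ⟨a, hinv, fun i hi => hout i (by omega), hnc, ?_, ?_⟩
      · intro i h1 h2
        rcases Nat.lt_or_ge t i with h | h
        · obtain rfl : i = t + 1 := by omega
          simp [hmem, hat]
        · exact hop i h1 h
      · rw [hIcc, filter_insert, filter_insert, if_pos hat, if_pos hmem,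
          card_insert_of_notMem (hnot _), card_insert_of_notMem (hnot _)]
        omega
    · rw [hIcc, filter_insert, if_neg hmem] at hSt ⊢
      have hne : {i ∈ Icc 1 t | a i = i}.Nonempty := card_pos.mp (by omega)
      obtain ⟨p, hp, hmax⟩ := exists_max_image _ id hne
      simp only [mem_filter, mem_Icc, id] at hp hmax
      obtain ⟨⟨hp1, hpt⟩, hap⟩ := hp
      have hpt' : p ≠ t + 1 := by omega
      have hle : ∀ i, i ≤ t → a i ≤ t := by
        intro i hi
        by_contra h
        have h1 := hout (a i) (by omega)
        have h2 := hinv i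
        omega
      let b : ℕ → ℕ := fun i => if i = p then t + 1 else if i = t + 1 then p else a i
      have hbp : b p = t + 1 := by simp [b]
      have hbt : b (t + 1) = p := by simp [b]
      have hb : ∀ i, i ≠ p → i ≠ t + 1 → b i = a i := by
        intro i h1 h2; simp [b, h1, h2]
      refine ⟨b, ?_, ?_, ?_, ?_, ?_⟩
      · intro i
        by_cases h1 : i = p
        · rw [h1, hbp, hbt]
        by_cases h2 : i = t + 1
        · rw [h2, hbt, hbp]
        rw [hb i h1 h2, hb, hinv]
        · intro h; have := hinv i; rw [h, hap] at this; omega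
        · intro h; have := hinv i; rw [h, hat] at this; omega
      · intro i hi
        rw [hb i (by omega) (by omega)]
        exact hout i (by omega)
      · grind
      · grind
      · have hfil : {i ∈ insert (t + 1) (Icc 1 t) | b i = i} =
            {i ∈ Icc 1 t | a i = i}.erase p := by
          ext i
          simp only [mem_filter, mem_insert, mem_erase, mem_Icc]
          grind
        rw [hfil, card_erase_of_mem (by simp [hp1, hpt, hap])]
        have := card_pos.mpr hne
        omega

open Finset in
/-- A balanced ballot sequence is the opener sequence of a crossingless matching. -/
theorem exists_isCrossinglessMatching (S : Finset ℕ) (m : ℕ)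
    (hS : ∀ t ≤ m, t ≤ 2 * #{i ∈ Icc 1 t | i ∈ S}) (hm : m = 2 * #{i ∈ Icc 1 m | i ∈ S}) :
    ∃ a, IsCrossinglessMatching m a ∧ ∀ i, 1 ≤ i → i ≤ m → (i ∈ S ↔ i < a i) := by
  obtain ⟨a, hinv, hout, hnc, hop, hcard⟩ :=
    exists_partial_crossingless_matching S m hS m le_rfl
  have hfix : ∀ i, 1 ≤ i → i ≤ m → a i ≠ i := by
    have h0 : #{i ∈ Icc 1 m | a i = i} = 0 := by omega
    rw [card_eq_zero, filter_eq_empty_iff] at h0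
    exact fun i h1 h2 => h0 (mem_Icc.mpr ⟨h1, h2⟩)
  refine ⟨a, ⟨fun i h1 h2 => ?_, fun i _ _ => hinv i, hfix,
    fun i j _ hij hj => (hnc i j hij hj).1, hout⟩, fun i h1 h2 => ?_⟩
  · by_contra h
    have h3 := hout (a i) (by omega)
    rw [hinv] at h3
    exact hfix i h1 h2 h3.symm
  · rw [hop i h1 h2]
    have := hfix i h1 h2
    omega

/-- A crossingless matching is determined by its openers. -/
theorem IsCrossinglessMatching.eq_of_openers {m : ℕ} {a b : ℕ → ℕ}
    (ha : IsCrossinglessMatching m a) (hb : IsCrossinglessMatching m b)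
    (h : ∀ i, 1 ≤ i → i ≤ m → (i < a i ↔ i < b i)) : a = b := by
  have key : ∀ c d : ℕ → ℕ, IsCrossinglessMatching m c → IsCrossinglessMatching m d →
      (∀ i, 1 ≤ i → i ≤ m → (i < c i ↔ i < d i)) → ∀ j, 1 ≤ j → j ≤ m →
      (∀ q < j, 1 ≤ q → c q < q → c q = d q) → d j < j → ¬ c j < d j := by
    rintro c d ⟨hc1, hc2, hc3, hc4, -⟩ ⟨hd1, hd2, hd3, hd4, -⟩ h j h1 h2 ih hdj hlt
    have hp := hd1 j h1 h2
    have hdp := hd2 j h1 h2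
    have hcj := hc2 j h1 h2
    have hcj1 := hc1 j h1 h2
    have hop : d j < c (d j) := (h _ hp.1 hp.2).2 (by omega)
    have hcp := hc2 _ hp.1 hp.2
    have hcp1 := hc1 _ hp.1 hp.2
    have hx := hc4 (c j) (d j) hcj1.1 hlt (by omega)
    rw [hcj] at hx
    have hne : c (d j) ≠ j := by
      intro he; rw [he] at hcp; omega
    have hq := ih (c (d j)) (by omega) hcp1.1 (by omega)
    have hdq := hd2 _ hcp1.1 hcp1.2
    rw [← hq, hcp] at hdq
    omega
  have closer : ∀ j, 1 ≤ j → j ≤ m → a j < j → a j = b j := by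
    intro j
    induction j using Nat.strong_induction_on with
    | _ j ih =>
      intro h1 h2 haj
      have hj := h j h1 h2
      have hbj := hb.2.2.1 j h1 h2
      have k1 := key a b ha hb h j h1 h2 (fun q hq q1 q2 => ih q hq q1 (by omega) q2) (by omega)
      have k2 := key b a hb ha (fun i i1 i2 => (h i i1 i2).symm) j h1 h2
        (fun q hq q1 q2 => by
          have := h q q1 (by omega)
          have := ha.2.2.1 q q1 (by omega)
          exact (ih q hq q1 (by omega) (by omega)).symm) haj
      omega
  obtain ⟨ha1, ha2, ha3, -, ha5⟩ := ha
  obtain ⟨hb1, hb2, hb3, -, hb5⟩ := hb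
  funext i
  by_cases hi : i = 0 ∨ m < i
  · rw [ha5 i hi, hb5 i hi]
  have h1 : 1 ≤ i := by omega
  have h2 : i ≤ m := by omega
  rcases lt_or_gt_of_ne (ha3 i h1 h2) with hlt | hgt
  · exact closer i h1 h2 hlt
  · have hr := ha1 i h1 h2
    have hi := ha2 i h1 h2
    have hc := closer (a i) hr.1 hr.2 (by omega)
    have hbb := hb2 (a i) hr.1 hr.2
    rw [← hc, hi] at hbb
    exact hbb.symm

open Finset in
/-- Half of the points of a crossingless matching are openers. -/
theorem IsCrossinglessMatching.two_mul_card_openers {m : ℕ} {a : ℕ → ℕ}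
    (ha : IsCrossinglessMatching m a) : 2 * #{i ∈ Icc 1 m | i < a i} = m := by
  obtain ⟨h1, h2, h3, -, -⟩ := ha
  have hbij : #{i ∈ Icc 1 m | i < a i} = #{i ∈ Icc 1 m | ¬ i < a i} := by
    refine card_nbij' a a ?_ ?_ ?_ ?_ <;> intro i hi <;>
      simp only [coe_filter, Set.mem_ofPred_eq, mem_Icc] at hi ⊢ <;> grind
  have := card_filter_add_card_filter_not (s := Icc 1 m) (fun i => i < a i)
  rw [Nat.card_Icc] at this
  omega

/-- In a platform matching the first platform consists of openers. -/
theorem IsPlatformMatching.lt_apply {n k₁ k₂ : ℕ} {a : ℕ → ℕ}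
    (ha : IsPlatformMatching n k₁ k₂ a) {i : ℕ} (h1 : 1 ≤ i) (h2 : i ≤ k₁) : i < a i := by
  obtain ⟨⟨hr, -, hf, -, -⟩, hp, -⟩ := ha
  have := hr i h1 (by omega)
  have := hf i h1 (by omega)
  by_contra h
  exact hp i (a i) h1 h2 (by omega) (by omega) (by omega) rfl

/-- In a platform matching the last platform consists of closers. -/
theorem IsPlatformMatching.apply_lt {n k₁ k₂ : ℕ} {a : ℕ → ℕ}
    (ha : IsPlatformMatching n k₁ k₂ a) {i : ℕ} (h1 : n + k₁ + 1 ≤ i)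
    (h2 : i ≤ n + k₁ + k₂) : a i < i := by
  obtain ⟨⟨hr, -, hf, -, -⟩, -, hp⟩ := ha
  have := hr i (by omega) (by omega)
  have := hf i (by omega) (by omega)
  by_contra h
  exact hp i (a i) h1 h2 (by omega) (by omega) (by omega) rfl

open Finset in
/-- The middle openers of a matching in `B(n; n - k, k)` number `k`. -/
theorem IsPlatformMatching.card_middle_openers {n k : ℕ} (hk : k ≤ n) {a : ℕ → ℕ}
    (ha : IsPlatformMatching n (n - k) k a) :
    #{i ∈ Icc (n - k + 1) (n + (n - k)) | i < a i} = k := by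
  have hcard := ha.1.two_mul_card_openers
  have hsplit : {i ∈ Icc 1 (n + (n - k) + k) | i < a i} =
      Icc 1 (n - k) ∪ {i ∈ Icc (n - k + 1) (n + (n - k)) | i < a i} := by
    ext i
    simp only [mem_filter, mem_union, mem_Icc]
    have h1 := @IsPlatformMatching.lt_apply _ _ _ _ ha i
    have h2 := @IsPlatformMatching.apply_lt _ _ _ _ ha i
    omega
  rw [hsplit, card_union_of_disjoint, Nat.card_Icc] at hcard
  · omega
  · rw [disjoint_left]
    intro i
    simp only [mem_filter, mem_Icc]
    omega

open Finset in
/-- Every `k`-subset of the middle points is the set of middle openers of a matching in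
`B(n; n - k, k)`. -/
theorem exists_isPlatformMatching {n k : ℕ} (hk : k ≤ n) {M : Finset ℕ}
    (hM : M ⊆ Icc (n - k + 1) (n + (n - k))) (hcard : #M = k) :
    ∃ a, IsPlatformMatching n (n - k) k a ∧
      {i ∈ Icc (n - k + 1) (n + (n - k)) | i < a i} = M := by
  have hM' : ∀ i ∈ M, n - k + 1 ≤ i ∧ i ≤ n + (n - k) := fun i hi => mem_Icc.mp (hM hi)
  have hdisj : Disjoint (Icc 1 (n - k)) M := by
    rw [disjoint_left]
    intro i hi hi'
    have := hM' i hi'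
    rw [mem_Icc] at hi
    omega
  set S := Icc 1 (n - k) ∪ M with hS
  have hScard : #S = n := by
    rw [hS, card_union_of_disjoint hdisj, Nat.card_Icc]
    omega
  have hmemS : ∀ i, i ∈ S ↔ (1 ≤ i ∧ i ≤ n - k) ∨ i ∈ M := by
    intro i; rw [hS, mem_union, mem_Icc]
  have hlarge : ∀ t, n + (n - k) ≤ t → {i ∈ Icc 1 t | i ∈ S} = S := by
    intro t ht
    ext i
    rw [mem_filter, hmemS, mem_Icc]
    have := hM' i
    grind
  obtain ⟨a, ha, hop⟩ := exists_isCrossinglessMatching S (n + (n - k) + k) (by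
    intro t ht
    have hsum := card_filter_add_card_filter_not (s := Icc 1 t) (fun i => i ∈ S)
    rw [Nat.card_Icc] at hsum
    rcases le_total (n + (n - k)) t with h | h
    · rw [hlarge t h]
      omega
    · have hclosers : #{i ∈ Icc 1 t | i ∉ S} ≤ n - k := by
        have hsub : {i ∈ Icc 1 t | i ∉ S} ⊆ Icc (n - k + 1) (n + (n - k)) \ M := by
          intro i
          rw [mem_filter, hmemS, mem_Icc, mem_sdiff, mem_Icc]
          grind
        have := card_le_card hsub
        rw [card_sdiff_of_subset hM, Nat.card_Icc] at this
        omega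
      rcases le_total t (n - k) with h' | h'
      · have : {i ∈ Icc 1 t | i ∈ S} = Icc 1 t := by
          ext i
          rw [mem_filter, hmemS, mem_Icc]
          omega
        rw [this, Nat.card_Icc]
        omega
      · have hge : #(Icc 1 (n - k)) ≤ #{i ∈ Icc 1 t | i ∈ S} := by
          apply card_le_card
          intro i
          rw [mem_filter, hmemS, mem_Icc, mem_Icc]
          omega
        rw [Nat.card_Icc] at hge
        omega) (by
    rw [hlarge _ (by omega)]
    omega)
  refine ⟨a, ⟨ha, ?_, ?_⟩, ?_⟩
  · rintro i j i1 i2 j1 j2 - rfl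
    have h1 := (hop i i1 (by omega)).1 ((hmemS i).2 (Or.inl ⟨i1, i2⟩))
    have h2 := (hop (a i) j1 (by omega)).1 ((hmemS _).2 (Or.inl ⟨j1, j2⟩))
    rw [ha.2.1 i i1 (by omega)] at h2
    omega
  · have hlast : ∀ i, n + (n - k) + 1 ≤ i → i ≤ n + (n - k) + k → ¬ i < a i := by
      intro i h1 h2
      rw [← hop i (by omega) h2, hmemS]
      have := hM' i
      grind
    rintro i j i1 i2 j1 j2 hne rfl
    have h1 := hlast i i1 i2
    have h2 := hlast (a i) j1 j2
    rw [ha.2.1 i (by omega) i2] at h2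
    omega
  · ext i
    rw [mem_filter, mem_Icc]
    have h1 := hop i
    have h2 := hmemS i
    have h3 := hM' i
    grind

/-- The number of crossingless matchings of `2n` points matching no two of the
first `n−k` points to each other and no two of the last `k` points to each
other is the binomial coefficient `C(n,k)`. -/
theorem card_platformMatching (n k : ℕ) (hk : k ≤ n) :
    Set.ncard {a : ℕ → ℕ | IsPlatformMatching n (n - k) k a} = Nat.choose n k := by
  let mid := Finset.Icc (n - k + 1) (n + (n - k))
  have hmid : mid.card = n := by
    simp only [mid, Nat.card_Icc]
    omega
  have hcount : (Finset.powersetCard k mid : Set (Finset ℕ)).ncard = Nat.choose n k := by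
    rw [Set.ncard_coe_finset, Finset.card_powersetCard, hmid]
  rw [← hcount]
  refine Set.ncard_congr (fun a _ => {i ∈ mid | i < a i}) ?_ ?_ ?_
  · intro a ha
    rw [Finset.mem_coe, Finset.mem_powersetCard]
    exact ⟨Finset.filter_subset _ _, IsPlatformMatching.card_middle_openers hk ha⟩
  · intro a b ha hb hab
    refine ha.1.eq_of_openers hb.1 fun i h1 h2 => ?_
    have hi := Finset.ext_iff.mp hab i
    simp only [Finset.mem_filter, mid, Finset.mem_Icc] at hi
    have ha1 := @IsPlatformMatching.lt_apply _ _ _ _ ha i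
    have ha2 := @IsPlatformMatching.apply_lt _ _ _ _ ha i
    have hb1 := @IsPlatformMatching.lt_apply _ _ _ _ hb i
    have hb2 := @IsPlatformMatching.apply_lt _ _ _ _ hb i
    omega
  · intro M hM
    rw [Finset.mem_coe, Finset.mem_powersetCard] at hM
    obtain ⟨a, ha, h⟩ := exists_isPlatformMatching hk hM.1 hM.2
    exact ⟨a, ha, h⟩
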